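/- Let Ĝ : ℍ^q → ℍ^k and 𝒵𝒢̂ : ℍ^q → ℍ^n be ℝ-linear maps on Hermitian matrices sending positive definite matrices to positive definite matrices, let S be an n×k complex matrix with S†S = I_k, let α ∈ [1/2,1), and define Ψ̂_α(ρ) := Tr[(Ĝ(ρ)^{1/2} S† 𝒵𝒢̂(ρ)^{(1−α)/α} S Ĝ(ρ)^{1/2})^α] for positive definite ρ ∈ ℍ^q. Fix such a ρ, and set G := Ĝ(ρ), Z := 𝒵𝒢̂(ρ), h(x) := x^{(1−α)/α}, g'(x) := α x^{α−1}, and Z_S := S† h(Z) S. Then for every Hermitian H ∈ ℍ^q, the directional derivative of Ψ̂_α at ρ in direction H equals Tr[ H · ( Ĝ†( Z_S^{1/2} g'(Z_S^{1/2} G Z_S^{1/2}) Z_S^{1/2} ) + 𝒵𝒢̂†( Dh(Z)[ S G^{1/2} g'(G^{1/2} Z_S G^{1/2}) G^{1/2} S† ] ) ) ], where Dh(Z)[M] denotes the Fréchet derivative at Z of the spectral function X ↦ h(X) in direction M, and Ĝ†, 𝒵𝒢̂† are the adjoints of Ĝ, 𝒵𝒢̂ with respect to the Hilbert–Schmidt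 inner product ⟨M,N⟩ = Tr[MN] on Hermitian matrices. -/

import Mathlib

open Matrix
open scoped ComplexOrder

attribute [local instance] Matrix.frobeniusNormedAddCommGroup Matrix.frobeniusNormedSpace

noncomputable section

/-- The real power of a matrix, taken via the continuous functional calculus applied to
`x ↦ x ^ p` (real `rpow`). -/
def mpow {n : ℕ} (A : Matrix (Fin n) (Fin n) ℂ) (p : ℝ) : Matrix (Fin n) (Fin n) ℂ :=
  cfc (fun x : ℝ => x ^ p) A

section SpectralCalculus

open Filter Topology

theorem Matrix.PosDef.spectrum_real_subset_Ioi {m : ℕ} {A : Matrix (Fin m) (Fin m) ℂ}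
    (hA : A.PosDef) : spectrum ℝ A ⊆ Set.Ioi 0 := by
  rw [hA.isHermitian.spectrum_real_eq_range_eigenvalues]
  rintro _ ⟨i, rfl⟩
  exact hA.eigenvalues_pos i

open scoped Matrix.Norms.L2Operator in
/-- Functional calculus by a function continuous on `(0, ∞)` is continuous along families of
positive definite matrices. -/
theorem tendsto_cfc_of_posDef {m : ℕ} {X : Type*} {l : Filter X} (f : ℝ → ℝ)
    (hf : ContinuousOn f (Set.Ioi 0)) {A : X → Matrix (Fin m) (Fin m) ℂ}
    {A₀ : Matrix (Fin m) (Fin m) ℂ} (hA : Tendsto A l (𝓝 A₀)) (hA₀ : A₀.PosDef)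
    (hpos : ∀ᶠ x in l, (A x).PosDef) :
    Tendsto (fun x => cfc f (A x)) l (𝓝 (cfc f A₀)) := by
  have key : ContinuousOn (fun B : Matrix (Fin m) (Fin m) ℂ => cfc f B) {B | B.PosDef} :=
    ContinuousOn.cfc_of_mem_nhdsSet (𝕜 := ℝ) (s := Set.Ioi 0) f
      (isOpen_Ioi.mem_nhdsSet.2 (Set.iUnion₂_subset fun B hB =>
        Matrix.PosDef.spectrum_real_subset_Ioi hB)) continuousOn_id
      (fun B hB => Matrix.PosDef.isHermitian hB) hf
  refine (key A₀ hA₀).tendsto.comp ?_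
  rw [tendsto_nhdsWithin_iff]
  exact ⟨hA, hpos⟩

open scoped Matrix.Norms.L2Operator in
/-- Among Hermitian matrices, positive definiteness is an open condition. -/
theorem eventually_posDef_of_tendsto {m : ℕ} {X : Type*} {l : Filter X}
    {A : X → Matrix (Fin m) (Fin m) ℂ} {A₀ : Matrix (Fin m) (Fin m) ℂ}
    (hA : Tendsto A l (𝓝 A₀)) (hA₀ : A₀.PosDef) (hherm : ∀ᶠ x in l, (A x).IsHermitian) :
    ∀ᶠ x in l, (A x).PosDef := by
  have h := (upperHemicontinuous_spectrum ℝ (Matrix (Fin m) (Fin m) ℂ)).isOpen (Set.Ioi 0)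
    |>.mem_nhds (x := A₀) (isOpen_Ioi.mem_nhdsSet.2 hA₀.spectrum_real_subset_Ioi)
  filter_upwards [hA h, hherm] with x hx hxh
  rw [hxh.posDef_iff_eigenvalues_pos]
  intro i
  exact subset_of_mem_nhdsSet hx (hxh.eigenvalues_mem_spectrum_real i)

/-- The trace pairing of spectral functions of two Hermitian matrices is a nonnegative
combination of products of their values at the eigenvalues. -/
theorem exists_trace_cfc_mul_cfc {m : ℕ} {X Y : Matrix (Fin m) (Fin m) ℂ}
    (hX : X.IsHermitian) (hY : Y.IsHermitian) :
    ∃ w : Fin m → Fin m → ℝ, (∀ i j, 0 ≤ w i j) ∧ ∀ a b : ℝ → ℝ,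
      (cfc a X * cfc b Y).trace.re
        = ∑ i, ∑ j, w i j * (a (hX.eigenvalues i) * b (hY.eigenvalues j)) := by
  set U : Matrix (Fin m) (Fin m) ℂ := hX.eigenvectorUnitary.1
  set V : Matrix (Fin m) (Fin m) ℂ := hY.eigenvectorUnitary.1
  refine ⟨fun i j => Complex.normSq ((Uᴴ * V) i j), fun i j => Complex.normSq_nonneg _, ?_⟩
  intro a b
  have h : (cfc a X * cfc b Y).trace
      = (diagonal (RCLike.ofReal ∘ a ∘ hX.eigenvalues) * (Uᴴ * V)
        * diagonal (RCLike.ofReal ∘ b ∘ hY.eigenvalues) * (Uᴴ * V)ᴴ).trace := by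
    rw [hX.cfc_eq, hY.cfc_eq, IsHermitian.cfc, IsHermitian.cfc, Unitary.conjStarAlgAut_apply,
      Unitary.conjStarAlgAut_apply, conjTranspose_mul, conjTranspose_conjTranspose]
    simp only [Matrix.mul_assoc]
    rw [Matrix.trace_mul_comm]
    simp only [Matrix.mul_assoc]
    rfl
  rw [h, Matrix.trace, Complex.re_sum]
  refine Finset.sum_congr rfl fun i _ => ?_
  rw [Matrix.diag_apply, Matrix.mul_apply, Complex.re_sum]
  refine Finset.sum_congr rfl fun j _ => ?_
  rw [Matrix.mul_diagonal, Matrix.diagonal_mul, conjTranspose_apply]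
  beta_reduce
  generalize (Uᴴ * V) i j = z
  simp [Complex.normSq_apply]
  ring

theorem Matrix.IsHermitian.continuousOn_spectrum {m : ℕ} {X : Matrix (Fin m) (Fin m) ℂ}
    (f : ℝ → ℝ) : ContinuousOn f (spectrum ℝ X) :=
  (Matrix.finite_real_spectrum (A := X)).continuousOn f

/-- Klein's inequality for a function lying below its tangent lines. -/
theorem trace_cfc_sub_le {m : ℕ} {f f' : ℝ → ℝ}
    (hff' : ∀ x > 0, ∀ y > 0, f y ≤ f x + f' x * (y - x))
    {X Y : Matrix (Fin m) (Fin m) ℂ} (hX : X.PosDef) (hY : Y.PosDef) :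
    (cfc f Y).trace.re - (cfc f X).trace.re ≤ (cfc f' X * (Y - X)).trace.re := by
  obtain ⟨w, hw, h⟩ := exists_trace_cfc_mul_cfc hX.isHermitian hY.isHermitian
  have hXs : IsSelfAdjoint X := hX.isHermitian
  have hYs : IsSelfAdjoint Y := hY.isHermitian
  have h1 := h 1 f
  have h2 := h f 1
  have h3 := h f' id
  have h4 := h (fun x => f' x * id x) 1
  rw [cfc_mul f' id X (IsHermitian.continuousOn_spectrum _) (IsHermitian.continuousOn_spectrum _)]
    at h4
  rw [cfc_one ℝ X, one_mul] at h1
  rw [cfc_one ℝ Y, mul_one] at h2 h4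
  rw [cfc_id ℝ Y] at h3
  rw [cfc_id ℝ X] at h4
  rw [Matrix.mul_sub, Matrix.trace_sub, Complex.sub_re, h1, h2, h3, h4]
  simp only [← Finset.sum_sub_distrib, ← mul_sub]
  refine Finset.sum_le_sum fun i _ => Finset.sum_le_sum fun j _ =>
    mul_le_mul_of_nonneg_left ?_ (hw i j)
  have := hff' _ (hX.eigenvalues_pos i) _ (hY.eigenvalues_pos j)
  simp only [Pi.one_apply, id]
  linarith

/-- First-order expansion of the trace of a spectral function along two curves of positive
definite matrices with a common limit. -/
theorem tendsto_trace_cfc_diffQuot {m : ℕ} {f f' : ℝ → ℝ}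
    (hff' : ∀ x > 0, ∀ y > 0, f y ≤ f x + f' x * (y - x)) (hf' : ContinuousOn f' (Set.Ioi 0))
    {X Y : ℝ → Matrix (Fin m) (Fin m) ℂ} {X₀ D : Matrix (Fin m) (Fin m) ℂ} (hX₀ : X₀.PosDef)
    (hXpos : ∀ᶠ t in 𝓝[≠] (0 : ℝ), (X t).PosDef) (hYpos : ∀ᶠ t in 𝓝[≠] (0 : ℝ), (Y t).PosDef)
    (hX : Tendsto X (𝓝[≠] 0) (𝓝 X₀)) (hY : Tendsto Y (𝓝[≠] 0) (𝓝 X₀))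
    (hD : Tendsto (fun t : ℝ => t⁻¹ • (Y t - X t)) (𝓝[≠] 0) (𝓝 D)) :
    Tendsto (fun t : ℝ => t⁻¹ * ((cfc f (Y t)).trace.re - (cfc f (X t)).trace.re)) (𝓝[≠] 0)
      (𝓝 (cfc f' X₀ * D).trace.re) := by
  have hcont : Continuous fun p : Matrix (Fin m) (Fin m) ℂ × Matrix (Fin m) (Fin m) ℂ =>
      (p.1 * p.2).trace.re := by fun_prop
  have hu := (hcont.tendsto (cfc f' X₀, D)).comp
    ((tendsto_cfc_of_posDef f' hf' hX hX₀ hXpos).prodMk_nhds hD)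
  have hv := (hcont.tendsto (cfc f' X₀, D)).comp
    ((tendsto_cfc_of_posDef f' hf' hY hX₀ hYpos).prodMk_nhds hD)
  have hmin := hu.min hv
  have hmax := hu.max hv
  rw [min_self] at hmin
  rw [max_self] at hmax
  have hbd : ∀ᶠ t in 𝓝[≠] (0 : ℝ),
      min (cfc f' (X t) * (t⁻¹ • (Y t - X t))).trace.re
          (cfc f' (Y t) * (t⁻¹ • (Y t - X t))).trace.re
        ≤ t⁻¹ * ((cfc f (Y t)).trace.re - (cfc f (X t)).trace.re) ∧
      t⁻¹ * ((cfc f (Y t)).trace.re - (cfc f (X t)).trace.re)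
        ≤ max (cfc f' (X t) * (t⁻¹ • (Y t - X t))).trace.re
          (cfc f' (Y t) * (t⁻¹ • (Y t - X t))).trace.re := by
    filter_upwards [hXpos, hYpos, self_mem_nhdsWithin] with t hXt hYt ht
    have h1 := trace_cfc_sub_le hff' hXt hYt
    have h2 := trace_cfc_sub_le hff' hYt hXt
    rw [← neg_sub (Y t) (X t), Matrix.mul_neg, Matrix.trace_neg, Complex.neg_re] at h2
    simp only [Matrix.mul_smul, Matrix.trace_smul, Complex.smul_re, smul_eq_mul]
    rcases lt_or_gt_of_ne (show t ≠ 0 from ht) with h | h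
    · have h0 := inv_lt_zero.2 h
      exact ⟨min_le_of_left_le (mul_le_mul_of_nonpos_left h1 h0.le),
        le_max_of_le_right (mul_le_mul_of_nonpos_left (by linarith) h0.le)⟩
    · have h0 := inv_pos.2 h
      exact ⟨min_le_of_right_le (mul_le_mul_of_nonneg_left (by linarith) h0.le),
        le_max_of_le_left (mul_le_mul_of_nonneg_left h1 h0.le)⟩
  exact tendsto_of_tendsto_of_tendsto_of_le_of_le' hmin hmax (hbd.mono fun _ h => h.1)
    (hbd.mono fun _ h => h.2)

/-- The trace of a spectral function of `W * Wᴴ` agrees with that of `Wᴴ * W`. -/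
theorem trace_cfc_mul_conjTranspose_self {m : ℕ} (f : ℝ → ℝ) (W : Matrix (Fin m) (Fin m) ℂ) :
    (cfc f (W * Wᴴ)).trace = (cfc f (Wᴴ * W)).trace := by
  have h1 : (W * Wᴴ).IsHermitian := isHermitian_mul_conjTranspose_self W
  have h2 : (Wᴴ * W).IsHermitian := isHermitian_conjTranspose_mul_self W
  have he : h1.eigenvalues = h2.eigenvalues :=
    (h1.eigenvalues_eq_eigenvalues_iff h2).2 (Matrix.charpoly_mul_comm _ _)
  have htr : ∀ {A : Matrix (Fin m) (Fin m) ℂ} (hA : A.IsHermitian),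
      (cfc f A).trace = ∑ i, (f (hA.eigenvalues i) : ℂ) := by
    intro A hA
    rw [hA.cfc_eq, IsHermitian.cfc, Unitary.conjStarAlgAut_apply, Matrix.trace_mul_cycle]
    simp [Matrix.trace]
  rw [htr h1, htr h2, he]

section PolynomialDerivative

attribute [local instance] Matrix.frobeniusNormedRing Matrix.frobeniusNormedAlgebra

/-- Polynomials of a matrix are differentiable along lines, and the derivative is symmetric for the
trace pairing, also after multiplication by a matrix commuting with the base point. -/
theorem exists_hasDerivAt_aeval {m : ℕ} (Z : Matrix (Fin m) (Fin m) ℂ) (p : Polynomial ℝ) :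
    ∃ d : Matrix (Fin m) (Fin m) ℂ → Matrix (Fin m) (Fin m) ℂ,
      (∀ M, HasDerivAt (fun t : ℝ => Polynomial.aeval (Z + t • M) p) (d M) 0) ∧
      ∀ Q, Commute Z Q → ∀ K M, (K * d M * Q).trace = (M * Q * d K).trace := by
  have hline : ∀ M : Matrix (Fin m) (Fin m) ℂ, HasDerivAt (fun t : ℝ => Z + t • M) M 0 := by
    intro M
    exact (((hasDerivAt_id (0 : ℝ)).smul_const M).const_add Z).congr_deriv (one_smul ℝ M)
  induction p using Polynomial.induction_on with
  | C a =>
    refine ⟨0, fun M => ?_, by simp⟩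
    simp only [Polynomial.aeval_C]
    exact hasDerivAt_const (0 : ℝ) (algebraMap ℝ (Matrix (Fin m) (Fin m) ℂ) a)
  | add p q hp hq =>
    obtain ⟨d, hd, hds⟩ := hp
    obtain ⟨e, he, hes⟩ := hq
    refine ⟨fun M => d M + e M, fun M => ?_, fun Q hQ K M => ?_⟩
    · simp only [map_add]
      exact (hd M).add (he M)
    · simp [Matrix.mul_add, Matrix.add_mul, hds Q hQ, hes Q hQ]
  | monomial n a hp =>
    obtain ⟨d, hd, hds⟩ := hp
    set P := Polynomial.C a * Polynomial.X ^ n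
    have hP : Polynomial.C a * Polynomial.X ^ (n + 1) = P * Polynomial.X := by
      rw [pow_succ, mul_assoc]
    have h1 : ∀ M, HasDerivAt (fun t : ℝ => Polynomial.aeval (Z + t • M) (P * Polynomial.X))
        (d M * Z + Polynomial.aeval Z P * M) 0 := by
      intro M
      simp only [map_mul, Polynomial.aeval_X]
      exact ((hd M).mul (hline M)).congr_deriv (by simp)
    have h2 : ∀ M, HasDerivAt (fun t : ℝ => Polynomial.aeval (Z + t • M) (P * Polynomial.X))
        (M * Polynomial.aeval Z P + Z * d M) 0 := by
      intro M
      rw [mul_comm]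
      simp only [map_mul, Polynomial.aeval_X]
      exact ((hline M).mul (hd M)).congr_deriv (by simp)
    rw [hP]
    refine ⟨_, h1, fun Q hQ K M => ?_⟩
    rw [(h1 K).unique (h2 K)]
    have h3 := hds (Z * Q) ((Commute.refl Z).mul_right hQ) K M
    rw [Matrix.mul_add, Matrix.add_mul, Matrix.mul_add, Matrix.trace_add, Matrix.trace_add,
      add_comm]
    congr 1
    · rw [Matrix.mul_assoc, Matrix.trace_mul_comm]
      simp only [Matrix.mul_assoc]
      rw [Matrix.trace_mul_comm]
      simp only [Matrix.mul_assoc]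
    · rw [hQ.eq] at h3
      simpa only [Matrix.mul_assoc, hQ.eq] using h3
end PolynomialDerivative

/-- A function continuous on `(0, ∞)` and differentiable at finitely many points of it equals a
polynomial plus a simple-zero polynomial times a continuous function. -/
theorem exists_interpolation_factorization {h : ℝ → ℝ} (hh : DifferentiableOn ℝ h (Set.Ioi 0))
    (s : Finset ℝ) :
    ∃ (L π : Polynomial ℝ) (r : ℝ → ℝ), ContinuousOn r (Set.Ioi 0) ∧ (∀ x ∈ s, π.eval x = 0) ∧
      ∀ x, h x = L.eval x + π.eval x * r x := by
  classical
  set L := Lagrange.interpolate s id h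
  set π := Lagrange.nodal s (id : ℝ → ℝ)
  have hL : ∀ x ∈ s, L.eval x = h x := fun x hx =>
    Lagrange.eval_interpolate_at_node (v := id) h Function.injective_id.injOn hx
  have hπ : ∀ x ∈ s, π.eval x = 0 := fun x hx => Lagrange.eval_nodal_at_node (v := id) hx
  have hπ0 : ∀ x ∉ s, π.eval x ≠ 0 := fun x hx =>
    Lagrange.eval_nodal_not_at_node (v := id) fun i hi h => hx (by simpa [h] using hi)
  have hπ' : ∀ x ∈ s, π.derivative.eval x ≠ 0 := by
    intro x hx h0
    have h1 := Lagrange.nodalWeight_eq_eval_derivative_nodal (v := (id : ℝ → ℝ)) hx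
    have h2 := Lagrange.nodalWeight_ne_zero (v := (id : ℝ → ℝ)) Function.injective_id.injOn hx
    rw [h1] at h2
    exact h2 (by simpa using h0)
  let r : ℝ → ℝ := fun x => if x ∈ s then (deriv h x - L.derivative.eval x) / π.derivative.eval x
    else (h x - L.eval x) / π.eval x
  have hr : ∀ x ∉ s, r x = (h x - L.eval x) / π.eval x := fun x hx => if_neg hx
  refine ⟨L, π, r, fun x hx => ContinuousAt.continuousWithinAt ?_, hπ, fun x => ?_⟩
  · have hd : HasDerivAt h (deriv h x) x :=
      ((hh x hx).differentiableAt (isOpen_Ioi.mem_nhds hx)).hasDerivAt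
    by_cases hxs : x ∈ s
    · have hn : HasDerivAt (fun y => h y - L.eval y) (deriv h x - L.derivative.eval x) x :=
        hd.sub (L.hasDerivAt x)
      have hlim := (hasDerivAt_iff_tendsto_slope.1 hn).div
        (hasDerivAt_iff_tendsto_slope.1 (π.hasDerivAt x)) (hπ' x hxs)
      rw [continuousAt_iff_punctured_nhds, show r x = _ from if_pos hxs]
      refine hlim.congr' ?_
      have hfin : ∀ᶠ y in 𝓝[≠] x, y ∉ s := by
        have : ((s.erase x : Finset ℝ) : Set ℝ)ᶜ ∈ 𝓝 x :=
          (s.erase x).finite_toSet.isClosed.isOpen_compl.mem_nhds (by simp)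
        filter_upwards [mem_nhdsWithin_of_mem_nhds this, self_mem_nhdsWithin] with y hy hyx hys
        exact hy (by simpa using ⟨hys, hyx⟩)
      filter_upwards [hfin, self_mem_nhdsWithin] with y hy hyx
      rw [Pi.div_apply, hr y hy, slope_def_field, slope_def_field, hL x hxs, hπ x hxs]
      have : y - x ≠ 0 := sub_ne_zero.2 hyx
      have := hπ0 y hy
      field_simp
      ring
    · have hc : ContinuousAt (fun y => (h y - L.eval y) / π.eval y) x :=
        (hd.continuousAt.sub L.continuous.continuousAt).div π.continuous.continuousAt (hπ0 x hxs)
      refine hc.congr ?_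
      filter_upwards [s.finite_toSet.isClosed.isOpen_compl.mem_nhds hxs] with y hy
      exact (hr y hy).symm
  · by_cases hxs : x ∈ s
    · simp [hL x hxs, hπ x hxs]
    · rw [hr x hxs]
      have := hπ0 x hxs
      field_simp
      ring

/-- The derivative along lines of a spectral function at a positive definite matrix is symmetric for
the trace pairing. -/
theorem trace_mul_deriv_cfc_comm {m : ℕ} {h : ℝ → ℝ} (hh : DifferentiableOn ℝ h (Set.Ioi 0))
    {Z K M DK DM : Matrix (Fin m) (Fin m) ℂ} (hZ : Z.PosDef) (hK : K.IsHermitian)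
    (hM : M.IsHermitian) (hDK : HasDerivAt (fun t : ℝ => cfc h (Z + t • K)) DK 0)
    (hDM : HasDerivAt (fun t : ℝ => cfc h (Z + t • M)) DM 0) :
    (K * DM).trace = (M * DK).trace := by
  classical
  have hspec : (spectrum ℝ Z).Finite := Matrix.finite_real_spectrum
  obtain ⟨L, π, r, hr, hπ, hfac⟩ := exists_interpolation_factorization hh hspec.toFinset
  obtain ⟨dL, hdL, hdLs⟩ := exists_hasDerivAt_aeval Z L
  obtain ⟨dπ, hdπ, hdπs⟩ := exists_hasDerivAt_aeval Z π
  have hsplit : ∀ A : Matrix (Fin m) (Fin m) ℂ, A.IsHermitian →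
      cfc h A = Polynomial.aeval A L + Polynomial.aeval A π * cfc r A := by
    intro A hA
    have hA' : IsSelfAdjoint A := hA
    have hc := fun f : ℝ → ℝ => IsHermitian.continuousOn_spectrum (X := A) f
    rw [← cfc_polynomial L A, ← cfc_polynomial π A, ← cfc_mul _ _ A (hc _) (hc _),
      ← cfc_add A _ _ (hc _) (hc _)]
    exact congrArg (fun f => cfc f A) (funext hfac)
  have hcomm : ∀ (p : Polynomial ℝ) (A : Matrix (Fin m) (Fin m) ℂ), A.IsHermitian →
      Commute (Polynomial.aeval A p) (cfc r A) := by
    intro p A hA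
    have hA' : IsSelfAdjoint A := hA
    rw [← cfc_polynomial p A]
    exact cfc_commute_cfc _ _ _
  have hπZ : Polynomial.aeval Z π = 0 := by
    have hZ' : IsSelfAdjoint Z := hZ.isHermitian
    rw [← cfc_polynomial π Z, ← cfc_zero ℝ Z]
    exact cfc_congr fun x hx => hπ x (by simpa using hx)
  have hline : ∀ N : Matrix (Fin m) (Fin m) ℂ,
      Tendsto (fun t : ℝ => Z + t • N) (𝓝[≠] 0) (𝓝 Z) := by
    intro N
    have : Continuous fun t : ℝ => Z + t • N := by fun_prop
    simpa using (this.tendsto 0).mono_left nhdsWithin_le_nhds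
  have hherm : ∀ N : Matrix (Fin m) (Fin m) ℂ, N.IsHermitian → ∀ t : ℝ,
      (Z + t • N).IsHermitian := fun N hN t =>
    hZ.isHermitian.add (hN.smul (IsSelfAdjoint.all t))
  have hrt : ∀ N : Matrix (Fin m) (Fin m) ℂ, N.IsHermitian →
      Tendsto (fun t : ℝ => cfc r (Z + t • N)) (𝓝[≠] 0) (𝓝 (cfc r Z)) := fun N hN =>
    tendsto_cfc_of_posDef r hr (hline N) hZ
      (eventually_posDef_of_tendsto (hline N) hZ (Eventually.of_forall (hherm N hN)))
  have hslope : ∀ (p : Polynomial ℝ) (N d : Matrix (Fin m) (Fin m) ℂ),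
      HasDerivAt (fun t : ℝ => Polynomial.aeval (Z + t • N) p) d 0 →
      Tendsto (fun t : ℝ => t⁻¹ • (Polynomial.aeval (Z + t • N) p - Polynomial.aeval Z p))
        (𝓝[≠] 0) (𝓝 d) := by
    intro p N d hd
    refine (hasDerivAt_iff_tendsto_slope.1 hd).congr fun t => ?_
    simp [slope]
  have hprod : ∀ N : Matrix (Fin m) (Fin m) ℂ, N.IsHermitian →
      ∀ D, HasDerivAt (fun t : ℝ => cfc h (Z + t • N)) D 0 →
        D = dL N + dπ N * cfc r Z ∧ D = dL N + cfc r Z * dπ N := by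
    intro N hN D hD
    have h0 := hasDerivAt_iff_tendsto_slope.1 hD
    have h1 := hslope L N _ (hdL N)
    have h2 := hslope π N _ (hdπ N)
    simp only [hπZ, sub_zero] at h2
    have hquot : ∀ t : ℝ, slope (fun t : ℝ => cfc h (Z + t • N)) 0 t
        = t⁻¹ • (Polynomial.aeval (Z + t • N) L - Polynomial.aeval Z L)
          + t⁻¹ • Polynomial.aeval (Z + t • N) π * cfc r (Z + t • N) := by
      intro t
      have hZ0 : cfc h Z = Polynomial.aeval Z L := by
        rw [hsplit Z hZ.isHermitian, hπZ, zero_mul, add_zero]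
      simp only [slope, vsub_eq_sub, sub_zero, zero_smul, add_zero, hZ0,
        hsplit _ (hherm N hN t), smul_mul_assoc, ← smul_add]
      congr 1
      abel
    constructor
    · exact tendsto_nhds_unique h0 ((h1.add (h2.mul (hrt N hN))).congr fun t => (hquot t).symm)
    · refine tendsto_nhds_unique h0 ((h1.add ((hrt N hN).mul h2)).congr fun t => ?_)
      rw [hquot t, ((hcomm π _ (hherm N hN t)).smul_left t⁻¹).eq]
  have hQ : Commute Z (cfc r Z) := by
    simpa using hcomm Polynomial.X Z hZ.isHermitian
  have e1 := hdLs 1 (Commute.one_right Z) K M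
  have e2 := hdπs _ hQ K M
  rw [(hprod M hM DM hDM).1, (hprod K hK DK hDK).2]
  simp only [Matrix.mul_add, Matrix.trace_add, mul_one, ← Matrix.mul_assoc] at e1 e2 ⊢
  rw [e1, e2]

theorem Matrix.IsHermitian.of_hasDerivAt {m : ℕ} {X : ℝ → Matrix (Fin m) (Fin m) ℂ}
    {D : Matrix (Fin m) (Fin m) ℂ} (hX : ∀ t, (X t).IsHermitian) {t₀ : ℝ}
    (hD : HasDerivAt X D t₀) : D.IsHermitian := by
  have hc : IsClosed {M : Matrix (Fin m) (Fin m) ℂ | Mᴴ = M} :=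
    isClosed_eq (by fun_prop) continuous_id
  refine hc.mem_of_tendsto (hasDerivAt_iff_tendsto_slope.1 hD) (Eventually.of_forall fun t => ?_)
  exact ((hX t).sub (hX t₀)).smul (IsSelfAdjoint.all (t - t₀)⁻¹)

theorem Matrix.isHermitian_cfc {m : ℕ} (f : ℝ → ℝ) (A : Matrix (Fin m) (Fin m) ℂ) :
    (cfc f A).IsHermitian :=
  cfc_predicate f A

theorem Matrix.PosDef.cfc {m : ℕ} {A : Matrix (Fin m) (Fin m) ℂ} (hA : A.PosDef) {f : ℝ → ℝ}
    (hf : ∀ x > 0, 0 < f x) : (cfc f A).PosDef := by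
  have hA' : IsSelfAdjoint A := hA.isHermitian
  rw [(isHermitian_cfc f A).posDef_iff_eigenvalues_pos]
  intro i
  have hi := (isHermitian_cfc f A).eigenvalues_mem_spectrum_real i
  rw [cfc_map_spectrum f A hA' (IsHermitian.continuousOn_spectrum f)] at hi
  obtain ⟨x, hx, hxi⟩ := hi
  rw [← hxi]
  exact hf x (hA.spectrum_real_subset_Ioi hx)

theorem Matrix.PosDef.mpow {m : ℕ} {A : Matrix (Fin m) (Fin m) ℂ} (hA : A.PosDef) (p : ℝ) :
    (mpow A p).PosDef :=
  hA.cfc fun _ hx => Real.rpow_pos_of_pos hx p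

theorem mpow_half_mul_mpow_half {m : ℕ} {A : Matrix (Fin m) (Fin m) ℂ} (hA : A.PosDef) :
    mpow A (1 / 2) * mpow A (1 / 2) = A := by
  have hA' : IsSelfAdjoint A := hA.isHermitian
  rw [mpow, ← cfc_mul _ _ A (IsHermitian.continuousOn_spectrum _)
    (IsHermitian.continuousOn_spectrum _)]
  conv_rhs => rw [← cfc_id ℝ A]
  refine cfc_congr fun x hx => ?_
  have hx0 : 0 < x := hA.spectrum_real_subset_Ioi hx
  simp only [id, ← Real.rpow_add hx0]
  norm_num

theorem Matrix.PosDef.mul_mul_self_of_posDef {m : ℕ} {A B : Matrix (Fin m) (Fin m) ℂ}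
    (hA : A.PosDef) (hB : B.PosDef) : (B * A * B).PosDef := by
  have h := hA.conjTranspose_mul_mul_same (B := B) (mulVec_injective_of_isUnit hB.isUnit)
  rwa [hB.isHermitian.eq] at h

theorem trace_cfc_mpow_half_comm {m : ℕ} (f : ℝ → ℝ) {A B : Matrix (Fin m) (Fin m) ℂ}
    (hA : A.PosDef) (hB : B.PosDef) :
    (cfc f (mpow A (1 / 2) * B * mpow A (1 / 2))).trace
      = (cfc f (mpow B (1 / 2) * A * mpow B (1 / 2))).trace := by
  have h := trace_cfc_mul_conjTranspose_self f (mpow A (1 / 2) * mpow B (1 / 2))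
  rw [conjTranspose_mul, (hA.mpow _).isHermitian.eq, (hB.mpow _).isHermitian.eq] at h
  have e1 : mpow A (1 / 2) * mpow B (1 / 2) * (mpow B (1 / 2) * mpow A (1 / 2))
      = mpow A (1 / 2) * (mpow B (1 / 2) * mpow B (1 / 2)) * mpow A (1 / 2) := by
    simp only [Matrix.mul_assoc]
  have e2 : mpow B (1 / 2) * mpow A (1 / 2) * (mpow A (1 / 2) * mpow B (1 / 2))
      = mpow B (1 / 2) * (mpow A (1 / 2) * mpow A (1 / 2)) * mpow B (1 / 2) := by
    simp only [Matrix.mul_assoc]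
  rwa [e1, e2, mpow_half_mul_mpow_half hA, mpow_half_mul_mpow_half hB] at h

theorem rpow_le_tangent {α x y : ℝ} (hα0 : 0 ≤ α) (hα1 : α ≤ 1) (hx : 0 < x) (hy : 0 < y) :
    y ^ α ≤ x ^ α + α * x ^ (α - 1) * (y - x) := by
  have h := rpow_one_add_le_one_add_mul_self (s := y / x - 1)
    (by have := div_pos hy hx; linarith) hα0 hα1
  rw [add_sub_cancel, Real.div_rpow hy.le hx.le, div_le_iff₀ (Real.rpow_pos_of_pos hx α)] at h
  refine h.trans_eq ?_
  rw [Real.rpow_sub_one hx.ne']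
  field_simp

/-- The derivative of `Tr[(A^{1/2} B A^{1/2})^α]` along curves of positive definite matrices. -/
theorem hasDerivAt_trace_mpow_mul_mul {m : ℕ} {α : ℝ} (hα0 : 0 ≤ α) (hα1 : α ≤ 1)
    {A B : ℝ → Matrix (Fin m) (Fin m) ℂ} {A' B' : Matrix (Fin m) (Fin m) ℂ}
    (hA : HasDerivAt A A' 0) (hB : HasDerivAt B B' 0)
    (hApos : ∀ᶠ t in 𝓝 0, (A t).PosDef) (hBpos : ∀ᶠ t in 𝓝 0, (B t).PosDef) :
    HasDerivAt
      (fun t : ℝ => (mpow (mpow (A t) (1 / 2) * B t * mpow (A t) (1 / 2)) α).trace.re)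
      ((A' * (mpow (B 0) (1 / 2) * cfc (fun x : ℝ => α * x ^ (α - 1))
          (mpow (B 0) (1 / 2) * A 0 * mpow (B 0) (1 / 2)) * mpow (B 0) (1 / 2))).trace.re
        + (B' * (mpow (A 0) (1 / 2) * cfc (fun x : ℝ => α * x ^ (α - 1))
          (mpow (A 0) (1 / 2) * B 0 * mpow (A 0) (1 / 2)) * mpow (A 0) (1 / 2))).trace.re) 0 := by
  have hA0 := hApos.self_of_nhds
  have hB0 := hBpos.self_of_nhds
  have hAp : ∀ᶠ t in 𝓝[≠] (0 : ℝ), (A t).PosDef := hApos.filter_mono nhdsWithin_le_nhds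
  have hBp : ∀ᶠ t in 𝓝[≠] (0 : ℝ), (B t).PosDef := hBpos.filter_mono nhdsWithin_le_nhds
  have hAt : Tendsto A (𝓝[≠] 0) (𝓝 (A 0)) := hA.continuousAt.tendsto.mono_left nhdsWithin_le_nhds
  have hBt : Tendsto B (𝓝[≠] 0) (𝓝 (B 0)) := hB.continuousAt.tendsto.mono_left nhdsWithin_le_nhds
  have hAs : Tendsto (fun t : ℝ => t⁻¹ • (A t - A 0)) (𝓝[≠] 0) (𝓝 A') :=
    (hasDerivAt_iff_tendsto_slope.1 hA).congr fun t => by simp [slope]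
  have hBs : Tendsto (fun t : ℝ => t⁻¹ • (B t - B 0)) (𝓝[≠] 0) (𝓝 B') :=
    (hasDerivAt_iff_tendsto_slope.1 hB).congr fun t => by simp [slope]
  have hQ : Tendsto (fun t => mpow (B t) (1 / 2)) (𝓝[≠] 0) (𝓝 (mpow (B 0) (1 / 2))) :=
    tendsto_cfc_of_posDef _
      (fun x hx => (Real.continuousAt_rpow_const x _ (Or.inl (ne_of_gt hx))).continuousWithinAt)
      hBt hB0 hBp
  have hg' : ContinuousOn (fun x : ℝ => α * x ^ (α - 1)) (Set.Ioi 0) := fun x hx =>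
    (continuousAt_const.mul
      (Real.continuousAt_rpow_const x _ (Or.inl (ne_of_gt hx)))).continuousWithinAt
  have htan : ∀ x > (0 : ℝ), ∀ y > (0 : ℝ),
      y ^ α ≤ x ^ α + α * x ^ (α - 1) * (y - x) := fun x hx y hy =>
    rpow_le_tangent hα0 hα1 hx hy
  have h1 := tendsto_trace_cfc_diffQuot htan hg'
    (X := fun t => mpow (B t) (1 / 2) * A 0 * mpow (B t) (1 / 2))
    (Y := fun t => mpow (B t) (1 / 2) * A t * mpow (B t) (1 / 2))
    (D := mpow (B 0) (1 / 2) * A' * mpow (B 0) (1 / 2))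
    (hA0.mul_mul_self_of_posDef (hB0.mpow _))
    (hBp.mono fun t ht => hA0.mul_mul_self_of_posDef (ht.mpow _))
    (by filter_upwards [hAp, hBp] with t ha hb using ha.mul_mul_self_of_posDef (hb.mpow _))
    ((hQ.mul tendsto_const_nhds).mul hQ) ((hQ.mul hAt).mul hQ)
    (((hQ.mul hAs).mul hQ).congr fun t => by
      simp only [Matrix.mul_smul, Matrix.smul_mul, Matrix.mul_sub, Matrix.sub_mul])
  have h2 := tendsto_trace_cfc_diffQuot htan hg'
    (X := fun _ => mpow (A 0) (1 / 2) * B 0 * mpow (A 0) (1 / 2))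
    (Y := fun t => mpow (A 0) (1 / 2) * B t * mpow (A 0) (1 / 2))
    (D := mpow (A 0) (1 / 2) * B' * mpow (A 0) (1 / 2))
    (hB0.mul_mul_self_of_posDef (hA0.mpow _))
    (Eventually.of_forall fun _ => hB0.mul_mul_self_of_posDef (hA0.mpow _))
    (hBp.mono fun t ht => ht.mul_mul_self_of_posDef (hA0.mpow _))
    tendsto_const_nhds ((tendsto_const_nhds.mul hBt).mul tendsto_const_nhds)
    (((tendsto_const_nhds.mul hBs).mul tendsto_const_nhds).congr fun t => by
      simp only [Matrix.mul_smul, Matrix.smul_mul, Matrix.mul_sub, Matrix.sub_mul])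
  have hcyc : ∀ P N C : Matrix (Fin m) (Fin m) ℂ,
      (C * (P * N * P)).trace = (N * (P * C * P)).trace := by
    intro P N C
    rw [Matrix.trace_mul_comm]
    simp only [Matrix.mul_assoc]
    rw [Matrix.trace_mul_comm]
    simp only [Matrix.mul_assoc]
  rw [hasDerivAt_iff_tendsto_slope]
  rw [hcyc] at h1 h2
  refine (h1.add h2).congr' ?_
  filter_upwards [hAp, hBp] with t hat hbt
  simp only [slope, vsub_eq_sub, sub_zero, smul_eq_mul]
  change _ = t⁻¹ *
    ((cfc (fun y : ℝ => y ^ α) (mpow (A t) (1 / 2) * B t * mpow (A t) (1 / 2))).trace.re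
      - (cfc (fun y : ℝ => y ^ α) (mpow (A 0) (1 / 2) * B 0 * mpow (A 0) (1 / 2))).trace.re)
  rw [trace_cfc_mpow_half_comm _ hat hbt, ← trace_cfc_mpow_half_comm _ hA0 hbt]
  ring

end SpectralCalculus

/-- Gradient formula for the FastRényiQKD functional
`Ψ̂_α(ρ) = Tr[(Ĝ(ρ)^{1/2} Sᴴ 𝒵𝒢̂(ρ)^{(1−α)/α} S Ĝ(ρ)^{1/2})^α]`: for Hermitian
directions `H`, the directional derivative at `ρ` equals
`Tr[H · (Ĝ†(Z_S^{1/2} g'(Z_S^{1/2} G Z_S^{1/2}) Z_S^{1/2})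
        + 𝒵𝒢̂†(Dh(Z)[S G^{1/2} g'(G^{1/2} Z_S G^{1/2}) G^{1/2} Sᴴ]))]`,
where `G = Ĝ(ρ)`, `Z = 𝒵𝒢̂(ρ)`, `h(x) = x^{(1−α)/α}`, `g'(x) = α x^{α−1}`,
`Z_S = Sᴴ h(Z) S`, and `Dh(Z)[·]` is the Fréchet derivative of the spectral function
`X ↦ h(X)` at `Z`. -/
theorem stmt17 {q k n : ℕ}
    (Ghat : Matrix (Fin q) (Fin q) ℂ →ₗ[ℝ] Matrix (Fin k) (Fin k) ℂ)
    (ZGhat : Matrix (Fin q) (Fin q) ℂ →ₗ[ℝ] Matrix (Fin n) (Fin n) ℂ)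
    (hGherm : ∀ M : Matrix (Fin q) (Fin q) ℂ, M.IsHermitian → (Ghat M).IsHermitian)
    (hZGherm : ∀ M : Matrix (Fin q) (Fin q) ℂ, M.IsHermitian → (ZGhat M).IsHermitian)
    (hGpd : ∀ M : Matrix (Fin q) (Fin q) ℂ, M.PosDef → (Ghat M).PosDef)
    (hZGpd : ∀ M : Matrix (Fin q) (Fin q) ℂ, M.PosDef → (ZGhat M).PosDef)
    (S : Matrix (Fin n) (Fin k) ℂ) (hS : Sᴴ * S = 1)
    (α : ℝ) (hα : α ∈ Set.Ico (1 / 2 : ℝ) 1)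
    (ρ : Matrix (Fin q) (Fin q) ℂ) (hρ : ρ.PosDef)
    (Gadj : Matrix (Fin k) (Fin k) ℂ →ₗ[ℝ] Matrix (Fin q) (Fin q) ℂ)
    (hGadj : ∀ (M : Matrix (Fin q) (Fin q) ℂ) (N : Matrix (Fin k) (Fin k) ℂ),
      M.IsHermitian → N.IsHermitian → (Ghat M * N).trace = (M * Gadj N).trace)
    (ZGadj : Matrix (Fin n) (Fin n) ℂ →ₗ[ℝ] Matrix (Fin q) (Fin q) ℂ)
    (hZGadj : ∀ (M : Matrix (Fin q) (Fin q) ℂ) (N : Matrix (Fin n) (Fin n) ℂ),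
      M.IsHermitian → N.IsHermitian → (ZGhat M * N).trace = (M * ZGadj N).trace)
    (Dh : Matrix (Fin n) (Fin n) ℂ →ₗ[ℝ] Matrix (Fin n) (Fin n) ℂ)
    (hDh : ∀ M : Matrix (Fin n) (Fin n) ℂ, M.IsHermitian →
      HasDerivAt (fun t : ℝ => mpow (ZGhat ρ + t • M) ((1 - α) / α)) (Dh M) 0) :
    ∀ H : Matrix (Fin q) (Fin q) ℂ, H.IsHermitian →
      HasDerivAt
        (fun t : ℝ =>
          ((mpow (mpow (Ghat (ρ + t • H)) (1 / 2) * Sᴴ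
            * mpow (ZGhat (ρ + t • H)) ((1 - α) / α) * S
            * mpow (Ghat (ρ + t • H)) (1 / 2)) α).trace).re)
        ((H *
          (Gadj
            (mpow (Sᴴ * mpow (ZGhat ρ) ((1 - α) / α) * S) (1 / 2)
              * cfc (fun x : ℝ => α * x ^ (α - 1))
                  (mpow (Sᴴ * mpow (ZGhat ρ) ((1 - α) / α) * S) (1 / 2) * Ghat ρ
                    * mpow (Sᴴ * mpow (ZGhat ρ) ((1 - α) / α) * S) (1 / 2))
              * mpow (Sᴴ * mpow (ZGhat ρ) ((1 - α) / α) * S) (1 / 2))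
          + ZGadj (Dh
              (S * mpow (Ghat ρ) (1 / 2)
                * cfc (fun x : ℝ => α * x ^ (α - 1))
                    (mpow (Ghat ρ) (1 / 2) * (Sᴴ * mpow (ZGhat ρ) ((1 - α) / α) * S)
                      * mpow (Ghat ρ) (1 / 2))
                * mpow (Ghat ρ) (1 / 2) * Sᴴ)))).trace).re
        0 := by
  intro H hH
  obtain ⟨hα0, hα1⟩ := hα
  set p := (1 - α) / α
  set g' : ℝ → ℝ := fun x => α * x ^ (α - 1)
  have hlin : ∀ {j : ℕ} (T : Matrix (Fin q) (Fin q) ℂ →ₗ[ℝ] Matrix (Fin j) (Fin j) ℂ) (t : ℝ),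
      T (ρ + t • H) = T ρ + t • T H := fun T t => by rw [map_add, map_smul]
  have hρpos : ∀ᶠ t in nhds (0 : ℝ), (ρ + t • H).PosDef := by
    have hc : Continuous fun t : ℝ => ρ + t • H := by fun_prop
    refine eventually_posDef_of_tendsto (by simpa using hc.tendsto 0) hρ
      (Filter.Eventually.of_forall fun t => hρ.isHermitian.add (hH.smul (IsSelfAdjoint.all t)))
  have hSinj : Function.Injective S.mulVec := by
    intro v w hvw
    have := congrArg (Sᴴ *ᵥ ·) hvw
    simpa [Matrix.mulVec_mulVec, hS] using this
  have hA : HasDerivAt (fun t : ℝ => Ghat (ρ + t • H)) (Ghat H) 0 := by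
    simp only [hlin]
    exact (((hasDerivAt_id (0 : ℝ)).smul_const (Ghat H)).const_add (Ghat ρ)).congr_deriv
      (one_smul ℝ _)
  have hZd := hDh (ZGhat H) (hZGherm H hH)
  have hB : HasDerivAt (fun t : ℝ => Sᴴ * mpow (ZGhat (ρ + t • H)) p * S)
      (Sᴴ * Dh (ZGhat H) * S) 0 := by
    simp only [hlin]
    refine hasDerivAt_iff_tendsto_slope.2 ?_
    have hc : Continuous fun M : Matrix (Fin n) (Fin n) ℂ => Sᴴ * M * S := by fun_prop
    refine ((hc.tendsto _).comp (hasDerivAt_iff_tendsto_slope.1 hZd)).congr fun t => ?_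
    simp [slope, Matrix.mul_sub, Matrix.sub_mul, smul_sub]
  have hmain := hasDerivAt_trace_mpow_mul_mul (by linarith : 0 ≤ α) hα1.le hA hB
    (hρpos.mono fun t ht => hGpd _ ht)
    (hρpos.mono fun t ht => ((hZGpd _ ht).mpow p).conjTranspose_mul_mul_same hSinj)
  simp only [zero_smul, add_zero] at hmain
  have hfun : ∀ t : ℝ, mpow (Ghat (ρ + t • H)) (1 / 2) * Sᴴ * mpow (ZGhat (ρ + t • H)) p * S
        * mpow (Ghat (ρ + t • H)) (1 / 2)
      = mpow (Ghat (ρ + t • H)) (1 / 2) * (Sᴴ * mpow (ZGhat (ρ + t • H)) p * S)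
        * mpow (Ghat (ρ + t • H)) (1 / 2) := fun t => by simp only [Matrix.mul_assoc]
  simp only [hfun]
  refine hmain.congr_deriv ?_
  set R := mpow (Ghat ρ) (1 / 2)
  set B := Sᴴ * mpow (ZGhat ρ) p * S
  set Q := mpow B (1 / 2)
  have hconj : ∀ {i j : ℕ} {N : Matrix (Fin i) (Fin i) ℂ} (C : Matrix (Fin j) (Fin i) ℂ),
      N.IsHermitian → (C * N * Cᴴ).IsHermitian := fun C hN =>
    isHermitian_mul_mul_conjTranspose C hN
  have hX : (Q * cfc g' (Q * Ghat ρ * Q) * Q).IsHermitian := by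
    have := hconj Q (isHermitian_cfc g' (Q * Ghat ρ * Q))
    rwa [show Qᴴ = Q from (isHermitian_cfc _ B).eq] at this
  have hY : (R * cfc g' (R * B * R) * R).IsHermitian := by
    have := hconj R (isHermitian_cfc g' (R * B * R))
    rwa [show Rᴴ = R from (isHermitian_cfc _ (Ghat ρ)).eq] at this
  have hN : S * R * cfc g' (R * B * R) * R * Sᴴ = S * (R * cfc g' (R * B * R) * R) * Sᴴ := by
    simp only [Matrix.mul_assoc]
  rw [hN]
  have hNh := hconj S hY
  have hDN := hDh _ hNh
  have hDNh : (Dh (S * (R * cfc g' (R * B * R) * R) * Sᴴ)).IsHermitian :=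
    IsHermitian.of_hasDerivAt (fun t => isHermitian_cfc _ _) hDN
  have hdiff : DifferentiableOn ℝ (fun x : ℝ => x ^ p) (Set.Ioi 0) := fun x hx =>
    (Real.differentiableAt_rpow_const_of_ne p (ne_of_gt hx)).differentiableWithinAt
  have hsymm := trace_mul_deriv_cfc_comm hdiff (hZGpd ρ hρ) (hZGherm H hH) hNh hZd hDN
  rw [Matrix.mul_add, Matrix.trace_add, Complex.add_re, ← hGadj H _ hH hX, ← hZGadj H _ hH hDNh,
    hsymm]
  have hcyc : ∀ (D : Matrix (Fin n) (Fin n) ℂ) (Y : Matrix (Fin k) (Fin k) ℂ),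
      (Sᴴ * D * S * Y).trace = (S * Y * Sᴴ * D).trace := by
    intro D Y
    rw [Matrix.mul_assoc Sᴴ, Matrix.mul_assoc Sᴴ, Matrix.trace_mul_comm Sᴴ,
      Matrix.mul_assoc D, Matrix.mul_assoc D, Matrix.trace_mul_comm D]
  rw [hcyc]

end
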